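/- Let M ⊆ ℤ^m be an affine monoid. Then M is normal if and only if for every face F of cone(M), gp(M) ∩ ℝF = gp(M ∩ F) and M is seminormal. -/

import Mathlib

noncomputable section

/-- The canonical embedding `ℤ^m → ℝ^m`. -/
def toR {m : ℕ} (x : Fin m → ℤ) : Fin m → ℝ := fun i => (x i : ℝ)

/-- The subgroup of `ℤ^m` generated by a submonoid `M`. -/
def gp {m : ℕ} (M : AddSubmonoid (Fin m → ℤ)) : AddSubgroup (Fin m → ℤ) :=
  AddSubgroup.closure (M : Set (Fin m → ℤ))

/-- The convex cone in `ℝ^m` generated by `M`: all nonnegative real combinations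
of elements of `M`. -/
def coneM {m : ℕ} (M : AddSubmonoid (Fin m → ℤ)) : Set (Fin m → ℝ) :=
  {x | ∃ (n : ℕ) (c : Fin n → ℝ) (v : Fin n → (Fin m → ℤ)),
    (∀ i, 0 ≤ c i) ∧ (∀ i, v i ∈ M) ∧ x = ∑ i, c i • toR (v i)}

/-- Faces of `coneM M`: the cone itself, or an intersection with a supporting
hyperplane given by a linear form nonnegative on the cone. -/
def IsFace {m : ℕ} (M : AddSubmonoid (Fin m → ℤ)) (F : Set (Fin m → ℝ)) : Prop :=
  F = coneM M ∨ ∃ α : (Fin m → ℝ) →ₗ[ℝ] ℝ,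
    (∀ x ∈ coneM M, 0 ≤ α x) ∧ F = {x ∈ coneM M | α x = 0}

/-- A facet: a maximal proper face. -/
def IsFacet {m : ℕ} (M : AddSubmonoid (Fin m → ℤ)) (F : Set (Fin m → ℝ)) : Prop :=
  IsFace M F ∧ F ≠ coneM M ∧ ∀ G, IsFace M G → F ⊆ G → G = F ∨ G = coneM M

/-- The subgroup `gp(M ∩ F)` of `ℤ^m` generated by the elements of `M` lying
in the face `F`. -/
def gpF {m : ℕ} (M : AddSubmonoid (Fin m → ℤ)) (F : Set (Fin m → ℝ)) :
    AddSubgroup (Fin m → ℤ) :=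
  AddSubgroup.closure {a : Fin m → ℤ | a ∈ M ∧ toR a ∈ F}

/-- `M` is seminormal: `z ∈ gp(M)`, `2z ∈ M`, `3z ∈ M` imply `z ∈ M`. -/
def Seminormal {m : ℕ} (M : AddSubmonoid (Fin m → ℤ)) : Prop :=
  ∀ z ∈ gp M, 2 • z ∈ M → 3 • z ∈ M → z ∈ M

/-- `M` is normal: `z ∈ gp(M)`, `kz ∈ M` for some `k ≥ 1` imply `z ∈ M`. -/
def IsNormal {m : ℕ} (M : AddSubmonoid (Fin m → ℤ)) : Prop :=
  ∀ z ∈ gp M, (∃ k : ℕ, 0 < k ∧ k • z ∈ M) → z ∈ M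

/-- `M` is positive: `0` is the only invertible element. -/
def Positive {m : ℕ} (M : AddSubmonoid (Fin m → ℤ)) : Prop :=
  ∀ a ∈ M, -a ∈ M → a = 0

/-- The localization monoid `M_F` of `M` at a face `F`:
elements `a ∈ gp(M)` with `a + b ∈ M` for some `b ∈ M ∩ F`. -/
def locM {m : ℕ} (M : AddSubmonoid (Fin m → ℤ)) (F : Set (Fin m → ℝ)) :
    Set (Fin m → ℤ) :=
  {a | a ∈ gp M ∧ ∃ b, b ∈ M ∧ toR b ∈ F ∧ a + b ∈ M}

/-- Farkas' lemma for the image of a finite set under a linear endomorphism. -/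
theorem farkas_image {K V : Type*} [Field K] [LinearOrder K] [IsStrictOrderedRing K]
    [AddCommGroup V] [Module K V] {s : Set V} (hs : s.Finite) :
    ∀ (π : V →ₗ[K] V) (x : V), x ∉ PointedCone.hull K (π '' s) →
      ∃ f : V →ₗ[K] K, (∀ y ∈ s, 0 ≤ f (π y)) ∧ f x < 0 := by
  induction s, hs using Set.Finite.induction_on with
  | empty =>
    intro π x hx
    have hx' : x ∉ (⊥ : Submodule K V) := by
      rintro h
      apply hx
      rw [Submodule.mem_bot] at h
      simp [h]
    obtain ⟨f, hf, -⟩ := Submodule.exists_le_ker_of_notMem hx'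
    rcases lt_or_gt_of_ne hf with h | h
    · exact ⟨f, by simp, h⟩
    · exact ⟨-f, by simp, by simpa using h⟩
  | @insert g s _ _ ih =>
    intro π x hx
    rw [Set.image_insert_eq] at hx
    obtain ⟨f, hf, hfx⟩ := ih π x fun h =>
      hx (Submodule.span_mono (Set.subset_insert _ _) h)
    by_cases hg : 0 ≤ f (π g)
    · refine ⟨f, ?_, hfx⟩
      rintro y (rfl | hy)
      exacts [hg, hf y hy]
    push Not at hg
    let ρ : V →ₗ[K] V := LinearMap.id - ((f (π g))⁻¹ • f).smulRight (π g)
    have hρ (v : V) : ρ v = v - ((f (π g))⁻¹ * f v) • π g := by simp [ρ]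
    have hρx : ρ x ∉ PointedCone.hull K ((ρ ∘ₗ π) '' s) := by
      intro h
      apply hx
      have himg : (ρ ∘ₗ π) '' s =
          (ρ.restrictScalars {c : K // 0 ≤ c}) '' (π '' s) := by
        rw [Set.image_image]; rfl
      rw [PointedCone.hull, himg, ← Submodule.map_span] at h
      obtain ⟨y, hy, hyx⟩ := h
      have hfy : 0 ≤ f y := by
        clear hyx
        induction hy using Submodule.span_induction with
        | mem y hy => obtain ⟨w, hw, rfl⟩ := hy; exact hf w hw
        | zero => simp
        | add y w _ _ hy hw => rw [map_add]; exact add_nonneg hy hw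
        | smul c y _ hy =>
          change 0 ≤ f (c.1 • y)
          rw [map_smul]
          exact mul_nonneg c.2 hy
      have hyx' : ρ y = ρ x := hyx
      rw [hρ, hρ] at hyx'
      refine Submodule.mem_span_insert.2
        ⟨⟨(f (π g))⁻¹ * (f x - f y), ?_⟩, y, hy, ?_⟩
      · exact mul_nonneg_of_nonpos_of_nonpos (inv_nonpos.2 hg.le) (by linarith)
      · change x = ((f (π g))⁻¹ * (f x - f y)) • π g + y
        exact (eq_add_of_sub_eq hyx'.symm).trans (by module)
    obtain ⟨h, hh, hhx⟩ := ih (ρ ∘ₗ π) (ρ x) hρx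
    refine ⟨h ∘ₗ ρ, ?_, hhx⟩
    rintro y (rfl | hy)
    · simp [hρ, hg.ne]
    · exact hh y hy

/-- The canonical embedding `ℤ^m → ℚ^m`. -/
def toQ {m : ℕ} : (Fin m → ℤ) →+ (Fin m → ℚ) := (Int.castAddHom ℚ).compLeft (Fin m)

theorem toQ_injective {m : ℕ} : Function.Injective (toQ (m := m)) := by
  intro x y h
  ext i
  have := congrFun h i
  simpa [toQ] using this

theorem exists_nsmul_mem_of_mem_cone {m : ℕ} {S : Set (Fin m → ℤ)} {y : Fin m → ℚ}
    (hy : y ∈ PointedCone.hull ℚ (toQ '' S)) :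
    ∃ n : ℕ, 0 < n ∧ ∃ w ∈ AddSubmonoid.closure S, n • y = toQ w := by
  induction hy using Submodule.span_induction with
  | mem y hy =>
    obtain ⟨w, hw, rfl⟩ := hy
    exact ⟨1, one_pos, w, AddSubmonoid.subset_closure hw, one_nsmul _⟩
  | zero => exact ⟨1, one_pos, 0, zero_mem _, by simp⟩
  | add y w _ _ hy hw =>
    obtain ⟨n, hn, a, ha, hna⟩ := hy
    obtain ⟨k, hk, b, hb, hkb⟩ := hw
    refine ⟨n * k, mul_pos hn hk, k • a + n • b,
      add_mem (nsmul_mem ha k) (nsmul_mem hb n), ?_⟩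
    rw [map_add, map_nsmul, map_nsmul, ← hna, ← hkb, nsmul_add, mul_comm, mul_nsmul', mul_comm,
      mul_nsmul']
  | smul c y _ hy =>
    obtain ⟨n, hn, a, ha, hna⟩ := hy
    obtain ⟨c, hc⟩ := c
    refine ⟨c.den * n, mul_pos c.den_pos hn, c.num.toNat • a, nsmul_mem ha _, ?_⟩
    have hnum : ((c.num.toNat : ℕ) : ℚ) = c.den * c := by
      rw [Rat.den_mul_eq_num]
      exact_mod_cast Int.toNat_of_nonneg (Rat.num_nonneg.2 hc)
    rw [map_nsmul, ← hna]
    change (c.den * n) • (c • y) = _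
    simp only [← Nat.cast_smul_eq_nsmul ℚ, smul_smul, Nat.cast_mul, hnum]
    ring_nf

theorem exists_nsmul_mem_of_mem_span {m : ℕ} {S : Set (Fin m → ℤ)} {y : Fin m → ℚ}
    (hy : y ∈ Submodule.span ℚ (toQ '' S)) :
    ∃ n : ℕ, 0 < n ∧ ∃ w ∈ AddSubgroup.closure S, n • y = toQ w := by
  induction hy using Submodule.span_induction with
  | mem y hy =>
    obtain ⟨w, hw, rfl⟩ := hy
    exact ⟨1, one_pos, w, AddSubgroup.subset_closure hw, one_nsmul _⟩
  | zero => exact ⟨1, one_pos, 0, zero_mem _, by simp⟩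
  | add y w _ _ hy hw =>
    obtain ⟨n, hn, a, ha, hna⟩ := hy
    obtain ⟨k, hk, b, hb, hkb⟩ := hw
    refine ⟨n * k, mul_pos hn hk, k • a + n • b,
      add_mem (nsmul_mem ha k) (nsmul_mem hb n), ?_⟩
    rw [map_add, map_nsmul, map_nsmul, ← hna, ← hkb, nsmul_add, mul_comm, mul_nsmul', mul_comm,
      mul_nsmul']
  | smul c y _ hy =>
    obtain ⟨n, hn, a, ha, hna⟩ := hy
    refine ⟨c.den * n, mul_pos c.den_pos hn, c.num • a, zsmul_mem ha _, ?_⟩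
    have hnum : (c.num : ℚ) = c.den * c := by rw [Rat.den_mul_eq_num]
    rw [map_zsmul, ← hna]
    simp only [← Nat.cast_smul_eq_nsmul ℚ, ← Int.cast_smul_eq_zsmul ℚ, smul_smul, Nat.cast_mul,
      hnum]
    ring_nf

theorem exists_real_extension {m : ℕ} (f : (Fin m → ℚ) →ₗ[ℚ] ℚ) :
    ∃ α : (Fin m → ℝ) →ₗ[ℝ] ℝ, ∀ x, α (toR x) = (f (toQ x) : ℝ) := by
  refine ⟨∑ i, (f (Pi.single i 1) : ℝ) • LinearMap.proj i, fun x => ?_⟩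
  rw [LinearMap.pi_apply_eq_sum_univ f (toQ x)]
  simp only [LinearMap.sum_apply, LinearMap.smul_apply, LinearMap.proj_apply, smul_eq_mul,
    Rat.cast_sum, Rat.cast_mul]
  refine Finset.sum_congr rfl fun i _ => ?_
  have hsingle : (fun j => if i = j then (1 : ℚ) else 0) = Pi.single i 1 := by
    ext j; simp [Pi.single_apply, eq_comm]
  rw [hsingle, mul_comm]
  simp [toR, toQ]

theorem exists_nsmul_mem_of_toR_mem_span {m : ℕ} {S : Set (Fin m → ℤ)} {z : Fin m → ℤ}
    (hz : toR z ∈ Submodule.span ℝ (toR '' S)) :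
    ∃ n : ℕ, 0 < n ∧ n • z ∈ AddSubgroup.closure S := by
  have hzQ : toQ z ∈ Submodule.span ℚ (toQ '' S) := by
    by_contra h
    obtain ⟨f, hfz, hf⟩ := Submodule.exists_le_ker_of_notMem h
    obtain ⟨α, hα⟩ := exists_real_extension f
    have hle : Submodule.span ℝ (toR '' S) ≤ LinearMap.ker α := by
      rw [Submodule.span_le]
      rintro _ ⟨s, hs, rfl⟩
      have : f (toQ s) = 0 := hf (Submodule.subset_span ⟨s, hs, rfl⟩)
      simp [hα, this]
    have := hle hz
    rw [LinearMap.mem_ker, hα] at this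
    exact hfz (by exact_mod_cast this)
  obtain ⟨n, hn, w, hw, hnw⟩ := exists_nsmul_mem_of_mem_span hzQ
  rw [← map_nsmul] at hnw
  exact ⟨n, hn, toQ_injective hnw ▸ hw⟩

theorem AddSubgroup.exists_add_eq_of_mem_closure {A : Type*} [AddCommGroup A]
    (S : AddSubmonoid A) {z : A} (hz : z ∈ AddSubgroup.closure (S : Set A)) :
    ∃ a ∈ S, ∃ b ∈ S, z + b = a := by
  induction hz using AddSubgroup.closure_induction with
  | mem x hx => exact ⟨x, hx, 0, zero_mem _, add_zero x⟩
  | zero => exact ⟨0, zero_mem _, 0, zero_mem _, add_zero 0⟩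
  | add x y _ _ hx hy =>
    obtain ⟨a, ha, b, hb, rfl⟩ := hx
    obtain ⟨c, hc, d, hd, rfl⟩ := hy
    exact ⟨_, add_mem ha hc, _, add_mem hb hd, by abel⟩
  | neg x _ hx =>
    obtain ⟨a, ha, b, hb, rfl⟩ := hx
    exact ⟨b, hb, _, ha, by abel⟩

theorem toR_add {m : ℕ} (x y : Fin m → ℤ) : toR (x + y) = toR x + toR y := by
  ext i; simp [toR]

theorem toR_zero {m : ℕ} : toR (0 : Fin m → ℤ) = 0 := by
  ext i; simp [toR]

theorem toR_nsmul {m : ℕ} (n : ℕ) (x : Fin m → ℤ) : toR (n • x) = (n : ℝ) • toR x := by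
  ext i; simp [toR]

theorem smul_toR_mem_coneM {m : ℕ} {M : AddSubmonoid (Fin m → ℤ)} {c : ℝ} (hc : 0 ≤ c)
    {a : Fin m → ℤ} (ha : a ∈ M) : c • toR a ∈ coneM M :=
  ⟨1, fun _ => c, fun _ => a, fun _ => hc, fun _ => ha, by simp⟩

theorem toR_mem_coneM {m : ℕ} {M : AddSubmonoid (Fin m → ℤ)} {a : Fin m → ℤ} (ha : a ∈ M) :
    toR a ∈ coneM M := by
  simpa using smul_toR_mem_coneM zero_le_one ha

/-- The submonoid of elements of `M` on which a linear form vanishes. -/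
def kerM {m : ℕ} (M : AddSubmonoid (Fin m → ℤ)) (α : (Fin m → ℝ) →ₗ[ℝ] ℝ) :
    AddSubmonoid (Fin m → ℤ) where
  carrier := {a | a ∈ M ∧ α (toR a) = 0}
  zero_mem' := ⟨zero_mem _, by simp [toR_zero]⟩
  add_mem' := fun {a b} ha hb => ⟨add_mem ha.1 hb.1, by simp [toR_add, ha.2, hb.2]⟩

theorem gpF_eq_closure_kerM {m : ℕ} (M : AddSubmonoid (Fin m → ℤ))
    (α : (Fin m → ℝ) →ₗ[ℝ] ℝ) :
    gpF M {x ∈ coneM M | α x = 0} = AddSubgroup.closure (kerM M α : Set (Fin m → ℤ)) := by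
  unfold gpF
  congr 1
  ext a
  exact ⟨fun h => ⟨h.1, h.2.2⟩, fun h => ⟨h.1, toR_mem_coneM h.1, h.2⟩⟩

theorem IsFace.exists_form {m : ℕ} {M : AddSubmonoid (Fin m → ℤ)} {F : Set (Fin m → ℝ)}
    (hF : IsFace M F) :
    ∃ α : (Fin m → ℝ) →ₗ[ℝ] ℝ, (∀ x ∈ coneM M, 0 ≤ α x) ∧ F = {x ∈ coneM M | α x = 0} := by
  rcases hF with rfl | h
  · exact ⟨0, by simp, by simp⟩
  · exact h

theorem face_subset_span {m : ℕ} {M : AddSubmonoid (Fin m → ℤ)} {α : (Fin m → ℝ) →ₗ[ℝ] ℝ}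
    (hα : ∀ x ∈ coneM M, 0 ≤ α x) :
    {x ∈ coneM M | α x = 0} ⊆ (Submodule.span ℝ (toR '' (kerM M α : Set (Fin m → ℤ))) : Set _) := by
  rintro x ⟨⟨n, c, v, hc, hv, rfl⟩, hx⟩
  rw [map_sum, Finset.sum_eq_zero_iff_of_nonneg
    fun i _ => hα _ (smul_toR_mem_coneM (hc i) (hv i))] at hx
  refine Submodule.sum_mem _ fun i hi => ?_
  have h := hx i hi
  rw [map_smul, smul_eq_mul, mul_eq_zero] at h
  rcases h with h | h
  · simp [h]
  · exact Submodule.smul_mem _ _ (Submodule.subset_span ⟨v i, ⟨hv i, h⟩, rfl⟩)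

theorem IsNormal.mem_gpF_iff {m : ℕ} {M : AddSubmonoid (Fin m → ℤ)} (hM : IsNormal M)
    {F : Set (Fin m → ℝ)} (hF : IsFace M F) (z : Fin m → ℤ) :
    (z ∈ gp M ∧ toR z ∈ Submodule.span ℝ F) ↔ z ∈ gpF M F := by
  obtain ⟨α, hα, rfl⟩ := hF.exists_form
  rw [gpF_eq_closure_kerM]
  constructor
  · rintro ⟨hz, hzF⟩
    obtain ⟨n, hn, hnz⟩ :=
      exists_nsmul_mem_of_toR_mem_span (Submodule.span_le.2 (face_subset_span hα) hzF)
    obtain ⟨a, ha, b, hb, hab⟩ := AddSubgroup.exists_add_eq_of_mem_closure _ hnz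
    have hsum : n • (z + b) = a + (n - 1) • b := by
      obtain ⟨k, rfl⟩ := Nat.exists_eq_succ_of_ne_zero hn.ne'
      rw [← hab, Nat.succ_sub_one, nsmul_add, succ_nsmul b]
      abel
    have hmem : n • (z + b) ∈ kerM M α := hsum ▸ add_mem ha (nsmul_mem hb _)
    have hzb : z + b ∈ kerM M α := by
      refine ⟨hM _ (add_mem hz (AddSubgroup.subset_closure hb.1)) ⟨n, hn, hmem.1⟩, ?_⟩
      have h := hmem.2
      rw [toR_nsmul, map_smul, smul_eq_mul, mul_eq_zero] at h
      exact h.resolve_left (by exact_mod_cast hn.ne')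
    have := sub_mem (AddSubgroup.subset_closure hzb) (AddSubgroup.subset_closure hb)
    rwa [add_sub_cancel_right] at this
  · intro hz
    refine ⟨AddSubgroup.closure_mono (fun a ha => ha.1) hz, ?_⟩
    obtain ⟨a, ha, b, hb, hab⟩ := AddSubgroup.exists_add_eq_of_mem_closure _ hz
    have hz' : toR z = toR a - toR b := by rw [← hab, toR_add, add_sub_cancel_right]
    rw [hz']
    exact sub_mem (Submodule.subset_span ⟨toR_mem_coneM ha.1, ha.2⟩)
      (Submodule.subset_span ⟨toR_mem_coneM hb.1, hb.2⟩)

theorem exists_supporting_form {m : ℕ} {M : AddSubmonoid (Fin m → ℤ)} (hFG : M.FG)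
    {z g : Fin m → ℤ} {k : ℕ} (hk : 0 < k) (hkz : k • z ∈ M) (hg : g ∈ M)
    (hbad : ∀ N : ℕ, N • z - g ∉ M) :
    ∃ f : (Fin m → ℚ) →ₗ[ℚ] ℚ, (∀ x ∈ M, 0 ≤ f (toQ x)) ∧ f (toQ z) = 0 ∧ 0 < f (toQ g) := by
  obtain ⟨G, hG⟩ := hFG
  have hnot : toQ (-g) ∉ PointedCone.hull ℚ
      ((LinearMap.id : (Fin m → ℚ) →ₗ[ℚ] _) '' (toQ '' (insert (-z) (G : Set (Fin m → ℤ))))) := by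
    intro h
    rw [LinearMap.id_coe, Set.image_id] at h
    obtain ⟨n, hn, w, hw, hnw⟩ := exists_nsmul_mem_of_mem_cone h
    rw [← map_nsmul] at hnw
    obtain rfl := toQ_injective hnw
    rw [Set.insert_eq, AddSubmonoid.closure_union, hG, AddSubmonoid.mem_sup] at hw
    obtain ⟨y, hy, x, hx, hyx⟩ := hw
    obtain ⟨N, rfl⟩ := AddSubmonoid.mem_closure_singleton.1 hy
    refine hbad N ?_
    have hxe : N • z - g = x + (n - 1) • g := by
      obtain ⟨j, rfl⟩ := Nat.exists_eq_succ_of_ne_zero hn.ne'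
      rw [eq_sub_of_add_eq' hyx, Nat.succ_sub_one, succ_nsmul]
      simp only [smul_neg]
      abel
    rw [hxe]
    exact add_mem hx (nsmul_mem hg _)
  obtain ⟨f, hf, hfg⟩ := farkas_image ((G.finite_toSet.insert (-z)).image toQ) _ _ hnot
  have hfM : ∀ x ∈ M, 0 ≤ f (toQ x) := by
    intro x hx
    rw [← hG] at hx
    induction hx using AddSubmonoid.closure_induction with
    | mem x hx => exact hf _ ⟨x, Set.mem_insert_of_mem _ hx, rfl⟩
    | zero => simp
    | add x y _ _ hx hy => rw [map_add, map_add]; exact add_nonneg hx hy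
  refine ⟨f, hfM, le_antisymm ?_ ?_, by simpa using hfg⟩
  · simpa using hf _ ⟨-z, Set.mem_insert _ _, rfl⟩
  · have h := hfM _ hkz
    rw [map_nsmul, map_nsmul, nsmul_eq_mul] at h
    exact nonneg_of_mul_nonneg_right h (by exact_mod_cast hk)

/-- The smallest face of the cone containing a given `z` is cut out by a supporting form. -/
theorem exists_minimal_face_form {m : ℕ} {M : AddSubmonoid (Fin m → ℤ)} (hFG : M.FG)
    {z : Fin m → ℤ} {k : ℕ} (hk : 0 < k) (hkz : k • z ∈ M) :
    ∃ α : (Fin m → ℝ) →ₗ[ℝ] ℝ, (∀ x ∈ coneM M, 0 ≤ α x) ∧ α (toR z) = 0 ∧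
      ∀ b ∈ kerM M α, ∃ N : ℕ, N • z - b ∈ M := by
  classical
  have hforms : ∀ g ∈ M, ∃ f : (Fin m → ℚ) →ₗ[ℚ] ℚ, (∀ x ∈ M, 0 ≤ f (toQ x)) ∧
      f (toQ z) = 0 ∧ (f (toQ g) = 0 → ∃ N : ℕ, N • z - g ∈ M) := by
    intro g hg
    by_cases hgood : ∃ N : ℕ, N • z - g ∈ M
    · exact ⟨0, by simp, by simp, fun _ => hgood⟩
    · obtain ⟨f, hf, hfz, hfg⟩ := exists_supporting_form hFG hk hkz hg (not_exists.1 hgood)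
      exact ⟨f, hf, hfz, fun h => absurd h hfg.ne'⟩
  choose! φ hφM hφz hφ using hforms
  obtain ⟨G, hG⟩ := hFG
  have hGM : ∀ g ∈ G, g ∈ M := fun g hg => hG ▸ AddSubmonoid.subset_closure hg
  obtain ⟨α, hα⟩ := exists_real_extension (∑ g ∈ G, φ g)
  have hαM : ∀ x ∈ M, 0 ≤ α (toR x) := by
    intro x hx
    rw [hα, LinearMap.sum_apply]
    exact_mod_cast Finset.sum_nonneg fun g hg => hφM g (hGM g hg) x hx
  refine ⟨α, ?_, ?_, ?_⟩
  · rintro _ ⟨n, c, v, hc, hv, rfl⟩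
    rw [map_sum]
    refine Finset.sum_nonneg fun i _ => ?_
    rw [map_smul]
    exact mul_nonneg (hc i) (hαM _ (hv i))
  · rw [hα, LinearMap.sum_apply, Finset.sum_eq_zero fun g hg => hφz g (hGM g hg), Rat.cast_zero]
  · rintro b ⟨hb, hb0⟩
    rw [← hG] at hb
    induction hb using AddSubmonoid.closure_induction with
    | mem g hg =>
      rw [hα, LinearMap.sum_apply, Rat.cast_eq_zero,
        Finset.sum_eq_zero_iff_of_nonneg fun i hi => hφM i (hGM i hi) g (hGM g hg)] at hb0
      exact hφ g (hGM g hg) (hb0 g hg)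
    | zero => exact ⟨0, by simp⟩
    | add x y hx hy ihx ihy =>
      rw [hG] at hx hy
      rw [toR_add, map_add] at hb0
      have hx0 := hαM x hx
      have hy0 := hαM y hy
      obtain ⟨N, hN⟩ := ihx (by linarith)
      obtain ⟨K, hK⟩ := ihy (by linarith)
      refine ⟨N + K, ?_⟩
      rw [add_nsmul, add_sub_add_comm]
      exact add_mem hN hK

theorem Seminormal.mem_of_forall_ge {m : ℕ} {M : AddSubmonoid (Fin m → ℤ)} (hM : Seminormal M)
    {z : Fin m → ℤ} (hz : z ∈ gp M) (n : ℕ) (h : ∀ k, n ≤ k → k • z ∈ M) : z ∈ M := by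
  induction n with
  | zero => simpa using h 1 (Nat.zero_le 1)
  | succ n ih =>
    rcases Nat.eq_zero_or_pos n with rfl | hn
    · simpa using h 1 le_rfl
    refine ih fun k hk => ?_
    rcases hk.eq_or_lt with rfl | hk
    · refine hM _ (nsmul_mem hz n) ?_ ?_
      · rw [smul_smul]; exact h _ (by omega)
      · rw [smul_smul]; exact h _ (by omega)
    · exact h k hk

theorem nsmul_mem_of_consecutive {A : Type*} [AddCommMonoid A] {M : AddSubmonoid A} {z : A}
    {N : ℕ} (h₀ : N • z ∈ M) (h₁ : (N + 1) • z ∈ M) (k : ℕ) (hk : N * N ≤ k) :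
    k • z ∈ M := by
  rcases Nat.eq_zero_or_pos N with rfl | hN
  · exact nsmul_mem (by simpa using h₁) k
  have hlt := Nat.mod_lt k hN
  have hle : N ≤ k / N := (Nat.le_div_iff_mul_le hN).2 hk
  obtain ⟨d, hd⟩ := Nat.exists_eq_add_of_le (hlt.le.trans hle)
  have hk' : k = d * N + (k % N) * (N + 1) := by
    have h := Nat.div_add_mod k N
    rw [hd] at h
    nlinarith
  rw [hk', add_nsmul, mul_nsmul', mul_nsmul']
  exact add_mem (nsmul_mem h₀ _) (nsmul_mem h₁ _)

theorem Seminormal.isNormal {m : ℕ} {M : AddSubmonoid (Fin m → ℤ)} (hFG : M.FG)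
    (hM : Seminormal M)
    (hF : ∀ F : Set (Fin m → ℝ), IsFace M F →
      ∀ z : Fin m → ℤ, z ∈ gp M → toR z ∈ Submodule.span ℝ F → z ∈ gpF M F) :
    IsNormal M := by
  rintro z hz ⟨k, hk, hkz⟩
  obtain ⟨α, hα, hαz, hN⟩ := exists_minimal_face_form hFG hk hkz
  have hzcone : toR z ∈ coneM M := by
    have h := smul_toR_mem_coneM (c := (k : ℝ)⁻¹) (by positivity) hkz
    rwa [toR_nsmul, smul_smul, inv_mul_cancel₀ (by exact_mod_cast hk.ne'), one_smul] at h
  have hzF := hF _ (Or.inr ⟨α, hα, rfl⟩) z hz (Submodule.subset_span ⟨hzcone, hαz⟩)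
  rw [gpF_eq_closure_kerM] at hzF
  obtain ⟨a, ha, b, hb, rfl⟩ := AddSubgroup.exists_add_eq_of_mem_closure _ hzF
  obtain ⟨N, hNb⟩ := hN b hb
  refine hM.mem_of_forall_ge hz (N * N) (nsmul_mem_of_consecutive ?_ ?_)
  · simpa using add_mem hNb hb.1
  · have := add_mem hNb ha.1
    rwa [sub_add_add_cancel, ← succ_nsmul] at this

/-- `M` is normal iff `M` is seminormal and
`gp(M) ∩ ℝF = gp(M ∩ F)` for every face `F` of `cone(M)`. -/
theorem normal_iff_seminormal_and_lattices {m : ℕ} (M : AddSubmonoid (Fin m → ℤ))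
    (hFG : M.FG) :
    IsNormal M ↔
      (Seminormal M ∧ ∀ F : Set (Fin m → ℝ), IsFace M F →
        ∀ z : Fin m → ℤ, (z ∈ gp M ∧ toR z ∈ Submodule.span ℝ F) ↔ z ∈ gpF M F) := by
  constructor
  · intro h
    exact ⟨fun z hz h₂ _ => h z hz ⟨2, two_pos, h₂⟩, fun F hF => h.mem_gpF_iff hF⟩
  · rintro ⟨hM, hF⟩
    exact hM.isNormal hFG fun F hFF z hz hzF => (hF F hFF z).1 ⟨hz, hzF⟩
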